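/- arXiv:2306.09493 — 4 statements merged into one kernel-verified Lean document; each statement's English description precedes it below -/
import Mathlib

section
/- Let N be a natural number, let {φ_{m,n,l}}_{m,n∈ℤ, l∈{1,…,N}} be a frame for L²(ℝ) with frame bounds A_1, B_1, and let {ψ_{m,n,l}}_{m,n∈ℤ, l∈{1,…,N}} be a dual frame of {φ_{m,n,l}} with frame bounds A_2, B_2. Then the family {φ_{m,n,l} + ψ_{m,n,l}}_{m,n∈ℤ, l∈{1,…,N}} is a frame for L²(ℝ) with frame bounds A_1 + A_2 + 2 (lower bound) and B_1 + B_2 + 2 (upper bound). -/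
open MeasureTheory
open scoped ComplexInnerProductSpace

noncomputable section

/-- `L²(ℝ)`: the space of (equivalence classes of) square-integrable complex-valued
functions on `ℝ`. -/
abbrev L2R := Lp ℂ 2 (volume : MeasureTheory.Measure ℝ)

/-- A family of vectors indexed by `ℤ × ℤ × {1,…,N}` is a frame for `L²(ℝ)` with
frame bounds `A`, `B` if `A‖f‖² ≤ Σ |⟨f, gₐ⟩|² ≤ B‖f‖²` for all `f`. -/
def IsFrame {N : ℕ} (g : ℤ × ℤ × Fin N → L2R) (A B : ℝ) : Prop :=
  0 < A ∧ A ≤ B ∧ ∀ f : L2R,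
    A * ‖f‖ ^ 2 ≤ (∑' idx : ℤ × ℤ × Fin N, ‖(⟪f, g idx⟫)‖ ^ 2) ∧
    (∑' idx : ℤ × ℤ × Fin N, ‖(⟪f, g idx⟫)‖ ^ 2) ≤ B * ‖f‖ ^ 2

/-- `ψ` is a dual family of `φ`: every `f ∈ L²(ℝ)` satisfies
`f = Σₐ ⟨f, φₐ⟩ ψₐ`, the series converging unconditionally.  (Here `⟨f, φₐ⟩`
denotes the inner product linear in the first argument, i.e. `⟪φₐ, f⟫` in
Mathlib's convention.) -/
def IsDual {N : ℕ} (φ ψ : ℤ × ℤ × Fin N → L2R) : Prop :=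
  ∀ f : L2R, HasSum (fun idx : ℤ × ℤ × Fin N => (⟪φ idx, f⟫) • ψ idx) f

/-- The positive lower frame bound forces summability of the frame coefficients. -/
theorem IsFrame.summable_sq {N : ℕ} {g : ℤ × ℤ × Fin N → L2R} {A B : ℝ}
    (h : IsFrame g A B) (f : L2R) :
    Summable (fun idx : ℤ × ℤ × Fin N => ‖(⟪f, g idx⟫)‖ ^ 2) := by
  obtain ⟨hA, _, hf⟩ := h
  by_cases h0 : f = 0
  · subst h0
    simpa using (summable_zero : Summable (fun _ : ℤ × ℤ × Fin N => (0 : ℝ)))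
  · by_contra hs
    have h1 := (hf f).1
    rw [tsum_eq_zero_of_not_summable hs] at h1
    have h2 : 0 < ‖f‖ := norm_pos_iff.mpr h0
    have h3 : 0 < A * ‖f‖ ^ 2 := by positivity
    linarith

/-- **Sum of a frame and its dual frame.**  If `{φₐ}` is a frame for `L²(ℝ)` with
bounds `A₁, B₁` and `{ψₐ}` is a dual frame of `{φₐ}` with bounds `A₂, B₂`, then
`{φₐ + ψₐ}` is a frame for `L²(ℝ)` with bounds `A₁ + A₂ + 2` and `B₁ + B₂ + 2`. -/
theorem frame_add_dual_isFrame (N : ℕ)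
    (φ ψ : ℤ × ℤ × Fin N → L2R) (A₁ B₁ A₂ B₂ : ℝ)
    (hφ : IsFrame φ A₁ B₁) (hψ : IsFrame ψ A₂ B₂)
    (hdual : IsDual φ ψ) :
    IsFrame (fun idx => φ idx + ψ idx) (A₁ + A₂ + 2) (B₁ + B₂ + 2) := by
  have key : ∀ f : L2R, (∑' idx : ℤ × ℤ × Fin N, ‖(⟪f, φ idx + ψ idx⟫)‖ ^ 2)
      = (∑' idx : ℤ × ℤ × Fin N, ‖(⟪f, φ idx⟫)‖ ^ 2)
        + (∑' idx : ℤ × ℤ × Fin N, ‖(⟪f, ψ idx⟫)‖ ^ 2) + 2 * ‖f‖ ^ 2 := by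
    intro f
    have h1 := (innerSL ℂ f).hasSum (hdual f)
    have h2 := (Complex.reCLM.hasSum h1).mul_left 2
    have h3 := ((hφ.summable_sq f).hasSum.add (hψ.summable_sq f).hasSum).add h2
    have h4 : Complex.reCLM (innerSL ℂ f f) = ‖f‖ ^ 2 := by
      rw [innerSL_apply_apply, inner_self_eq_norm_sq_to_K]
      norm_cast
    rw [h4] at h3
    rw [← h3.tsum_eq]
    congr 1
    funext idx
    have h5 : (⟪φ idx, f⟫ : ℂ) = (starRingEnd ℂ) ⟪f, φ idx⟫ := (inner_conj_symm _ _).symm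
    simp only [Function.comp, innerSL_apply_apply, inner_smul_right, inner_add_right, h5]
    rw [← Complex.normSq_eq_norm_sq, ← Complex.normSq_eq_norm_sq, ← Complex.normSq_eq_norm_sq]
    simp only [Complex.normSq_apply, Complex.reCLM_apply, Complex.add_re, Complex.add_im,
      Complex.mul_re, Complex.conj_re, Complex.conj_im]
    ring
  obtain ⟨a1, b1, c1⟩ := hφ
  obtain ⟨a2, b2, c2⟩ := hψ
  refine ⟨by linarith, by linarith, fun f => ?_⟩
  rw [key f]
  obtain ⟨p1, q1⟩ := c1 f
  obtain ⟨p2, q2⟩ := c2 f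
  constructor <;> linarith
end
end

section
/- Let N be a natural number, let {φ_{m,n,l}}_{m,n∈ℤ, l∈{1,…,N}} and {ψ_{m,n,l}}_{m,n∈ℤ, l∈{1,…,N}} be frames for L²(ℝ) with frame bounds A_1, B_1 and A_2, B_2 respectively. Let Θ_1, Θ_2 be bounded linear operators on L²(ℝ) whose Hilbert adjoints Θ_1*, Θ_2* are bounded below by constants m_1 > 0 and m_2 > 0 respectively (i.e. ‖Θ_i* f‖ ≥ m_i ‖f‖ for all f), and assume A_1 m_1² + A_2 m_2² > 2 √(B_1 B_2) ‖Θ_1‖ ‖Θ_2‖. Then {Θ_1 φ_{m,n,l} + Θ_2 ψ_{m,n,l}}_{m,n∈ℤ, l∈{1,…,N}} is a frame for L²(ℝ) with frame bounds A_1 m_1² + A_2 m_2² − 2 √(B_1 B_2) ‖Θ_1‖ ‖Θ_2‖ (lower bound) and (√(B_1) ‖Θ_1‖ + √(B_2) ‖Θ_2‖)² (upper bound). -/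
open MeasureTheory ContinuousLinearMap
open scoped ComplexInnerProductSpace

noncomputable section

theorem tsum_core {ι : Type*} (a b : ι → ℂ) (ha : Summable fun i => ‖a i‖ ^ 2)
    (hb : Summable fun i => ‖b i‖ ^ 2) :
    (∑' i, ‖a i‖ ^ 2) + (∑' i, ‖b i‖ ^ 2)
        - 2 * (Real.sqrt (∑' i, ‖a i‖ ^ 2) * Real.sqrt (∑' i, ‖b i‖ ^ 2))
      ≤ ∑' i, ‖a i + b i‖ ^ 2 ∧
    ∑' i, ‖a i + b i‖ ^ 2 ≤ (∑' i, ‖a i‖ ^ 2) + (∑' i, ‖b i‖ ^ 2)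
        + 2 * (Real.sqrt (∑' i, ‖a i‖ ^ 2) * Real.sqrt (∑' i, ‖b i‖ ^ 2)) := by
  have hab : Summable fun i => ‖a i‖ * ‖b i‖ :=
    Summable.of_nonneg_of_le (fun i => by positivity)
      (fun i => by nlinarith [sq_nonneg (‖a i‖ - ‖b i‖), sq_nonneg (‖a i‖), sq_nonneg (‖b i‖)])
      (ha.add hb)
  have hP : ∑' i, ‖a i‖ * ‖b i‖
      ≤ Real.sqrt (∑' i, ‖a i‖ ^ 2) * Real.sqrt (∑' i, ‖b i‖ ^ 2) := by
    refine hab.tsum_le_of_sum_le fun s => ?_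
    refine (Real.sum_mul_le_sqrt_mul_sqrt s _ _).trans ?_
    gcongr
    · exact ha.sum_le_tsum s (fun i _ => by positivity)
    · exact hb.sum_le_tsum s (fun i _ => by positivity)
  have hup : ∀ i, ‖a i + b i‖ ^ 2 ≤ ‖a i‖ ^ 2 + ‖b i‖ ^ 2 + 2 * (‖a i‖ * ‖b i‖) := fun i => by
    nlinarith [norm_add_le (a i) (b i), norm_nonneg (a i + b i)]
  have hlo : ∀ i, ‖a i‖ ^ 2 + ‖b i‖ ^ 2 - 2 * (‖a i‖ * ‖b i‖) ≤ ‖a i + b i‖ ^ 2 := fun i => by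
    have h1 : |‖a i‖ - ‖b i‖| ≤ ‖a i + b i‖ := by
      have := abs_norm_sub_norm_le (a i) (-b i)
      simpa using this
    have h2 := pow_le_pow_left₀ (abs_nonneg _) h1 2
    rw [sq_abs] at h2
    linarith
  have hs2 := hab.mul_left 2
  have hsU := (ha.add hb).add hs2
  have hsL := (ha.add hb).sub hs2
  have hs : Summable fun i => ‖a i + b i‖ ^ 2 :=
    Summable.of_nonneg_of_le (fun i => by positivity) hup hsU
  have e1 := hs.tsum_le_tsum hup hsU
  have e2 := hsL.tsum_le_tsum hlo hs
  rw [(ha.add hb).tsum_add hs2, ha.tsum_add hb, tsum_mul_left] at e1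
  rw [(ha.add hb).tsum_sub hs2, ha.tsum_add hb, tsum_mul_left] at e2
  constructor <;> linarith

theorem IsFrame.summable {N : ℕ} {g : ℤ × ℤ × Fin N → L2R} {A B : ℝ} (h : IsFrame g A B)
    (f : L2R) : Summable fun idx => ‖(⟪f, g idx⟫)‖ ^ 2 := by
  by_cases hf : f = 0
  · subst hf
    simpa using summable_zero
  · by_contra hn
    have := (h.2.2 f).1
    rw [tsum_eq_zero_of_not_summable hn] at this
    have h2 : 0 < A * ‖f‖ ^ 2 := mul_pos h.1 (pow_pos (norm_pos_iff.2 hf) 2)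
    linarith

theorem exists_L2R_ne_zero : ∃ f : L2R, f ≠ 0 := by
  refine ⟨indicatorConstLp 2 (measurableSet_Icc (a := (0:ℝ)) (b := 1)) (by simp) (1:ℂ), ?_⟩
  rw [← norm_ne_zero_iff, norm_indicatorConstLp (by simp) (by simp)]
  simp

/-- **Sum of images of frames under bounded operators.**  If `{φₐ}`, `{ψₐ}` are frames
for `L²(ℝ)` with bounds `A₁, B₁` and `A₂, B₂`, and `Θ₁, Θ₂` are bounded linear operators
on `L²(ℝ)` whose Hilbert adjoints are bounded below by `m₁ > 0`, `m₂ > 0`, and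
`A₁ m₁² + A₂ m₂² > 2 √(B₁ B₂) ‖Θ₁‖ ‖Θ₂‖`, then `{Θ₁ φₐ + Θ₂ ψₐ}` is a frame for
`L²(ℝ)` with bounds `A₁ m₁² + A₂ m₂² − 2 √(B₁ B₂) ‖Θ₁‖ ‖Θ₂‖` and
`(√B₁ ‖Θ₁‖ + √B₂ ‖Θ₂‖)²`. -/
theorem operator_sum_of_frames_isFrame (N : ℕ)
    (φ ψ : ℤ × ℤ × Fin N → L2R) (A₁ B₁ A₂ B₂ : ℝ)
    (hφ : IsFrame φ A₁ B₁) (hψ : IsFrame ψ A₂ B₂)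
    (Θ₁ Θ₂ : L2R →L[ℂ] L2R) (m₁ m₂ : ℝ) (hm₁ : 0 < m₁) (hm₂ : 0 < m₂)
    (hΘ₁ : ∀ f : L2R, m₁ * ‖f‖ ≤ ‖adjoint Θ₁ f‖)
    (hΘ₂ : ∀ f : L2R, m₂ * ‖f‖ ≤ ‖adjoint Θ₂ f‖)
    (hcond : 2 * Real.sqrt (B₁ * B₂) * ‖Θ₁‖ * ‖Θ₂‖ < A₁ * m₁ ^ 2 + A₂ * m₂ ^ 2) :
    IsFrame (fun idx => Θ₁ (φ idx) + Θ₂ (ψ idx))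
      (A₁ * m₁ ^ 2 + A₂ * m₂ ^ 2 - 2 * Real.sqrt (B₁ * B₂) * ‖Θ₁‖ * ‖Θ₂‖)
      ((Real.sqrt B₁ * ‖Θ₁‖ + Real.sqrt B₂ * ‖Θ₂‖) ^ 2) := by
  have hA₁ := hφ.1
  have hA₂ := hψ.1
  have hB₁ : 0 ≤ B₁ := hA₁.le.trans hφ.2.1
  have hB₂ : 0 ≤ B₂ := hA₂.le.trans hψ.2.1
  have key : ∀ f : L2R,
      (A₁ * m₁ ^ 2 + A₂ * m₂ ^ 2 - 2 * Real.sqrt (B₁ * B₂) * ‖Θ₁‖ * ‖Θ₂‖) * ‖f‖ ^ 2 ≤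
        (∑' idx : ℤ × ℤ × Fin N, ‖(⟪f, Θ₁ (φ idx) + Θ₂ (ψ idx)⟫)‖ ^ 2) ∧
      (∑' idx : ℤ × ℤ × Fin N, ‖(⟪f, Θ₁ (φ idx) + Θ₂ (ψ idx)⟫)‖ ^ 2) ≤
        ((Real.sqrt B₁ * ‖Θ₁‖ + Real.sqrt B₂ * ‖Θ₂‖) ^ 2) * ‖f‖ ^ 2 := by
    intro f
    have hc := tsum_core _ _ (hφ.summable (adjoint Θ₁ f)) (hψ.summable (adjoint Θ₂ f))
    obtain ⟨l1, u1⟩ := hφ.2.2 (adjoint Θ₁ f)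
    obtain ⟨l2, u2⟩ := hψ.2.2 (adjoint Θ₂ f)
    have hn1 : ‖adjoint Θ₁ f‖ ≤ ‖Θ₁‖ * ‖f‖ := by
      simpa using (adjoint Θ₁).le_opNorm f
    have hn2 : ‖adjoint Θ₂ f‖ ≤ ‖Θ₂‖ * ‖f‖ := by
      simpa using (adjoint Θ₂).le_opNorm f
    have hk1 := hΘ₁ f
    have hk2 := hΘ₂ f
    have hcongr : (∑' idx : ℤ × ℤ × Fin N, ‖(⟪f, Θ₁ (φ idx) + Θ₂ (ψ idx)⟫)‖ ^ 2)
        = ∑' idx : ℤ × ℤ × Fin N,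
          ‖(⟪adjoint Θ₁ f, φ idx⟫) + (⟪adjoint Θ₂ f, ψ idx⟫)‖ ^ 2 := by
      refine tsum_congr fun i => ?_
      rw [inner_add_right, adjoint_inner_left, adjoint_inner_left]
    rw [hcongr]
    have aux : ∀ {S B n t F : ℝ}, 0 ≤ B → 0 ≤ n → 0 ≤ t → 0 ≤ F → S ≤ B * n ^ 2 → n ≤ t * F →
        Real.sqrt S ≤ Real.sqrt B * t * F := by
      intro S B n t F hB hn ht hF h1 h2
      refine Real.sqrt_le_iff.2 ⟨by positivity, h1.trans ?_⟩
      have : (Real.sqrt B * t * F) ^ 2 = B * (t * F) ^ 2 := by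
        rw [mul_assoc, mul_pow, Real.sq_sqrt hB]
      rw [this]
      gcongr
    have s1 := aux hB₁ (norm_nonneg _) (norm_nonneg _) (norm_nonneg _) u1 hn1
    have s2 := aux hB₂ (norm_nonneg _) (norm_nonneg _) (norm_nonneg _) u2 hn2
    have L1 := (mul_le_mul_of_nonneg_left
      (pow_le_pow_left₀ (by positivity) hk1 2) hA₁.le).trans l1
    have L2 := (mul_le_mul_of_nonneg_left
      (pow_le_pow_left₀ (by positivity) hk2 2) hA₂.le).trans l2
    have q1 : 0 ≤ ∑' idx, ‖(⟪adjoint Θ₁ f, φ idx⟫)‖ ^ 2 := tsum_nonneg fun _ => by positivity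
    have q2 : 0 ≤ ∑' idx, ‖(⟪adjoint Θ₂ f, ψ idx⟫)‖ ^ 2 := tsum_nonneg fun _ => by positivity
    obtain ⟨c1, c2⟩ := hc
    have r1 := Real.sq_sqrt q1
    have r2 := Real.sq_sqrt q2
    have p1 := Real.sqrt_nonneg (∑' idx, ‖(⟪adjoint Θ₁ f, φ idx⟫)‖ ^ 2)
    have p2 := Real.sqrt_nonneg (∑' idx, ‖(⟪adjoint Θ₂ f, ψ idx⟫)‖ ^ 2)
    have hmul := mul_le_mul s1 s2 p2 (p1.trans s1)
    constructor
    · rw [Real.sqrt_mul hB₁]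
      refine le_trans ?_ c1
      linarith
    · refine c2.trans ?_
      have hadd := pow_le_pow_left₀ (add_nonneg p1 p2) (add_le_add s1 s2) 2
      linarith
  refine ⟨by linarith, ?_, key⟩
  obtain ⟨f, hf⟩ := exists_L2R_ne_zero
  have hf2 : 0 < ‖f‖ ^ 2 := pow_pos (norm_pos_iff.2 hf) 2
  exact le_of_mul_le_mul_right ((key f).1.trans (key f).2) hf2
end
end

section
/- Let N be a natural number, let {φ_{m,n,l}}_{m,n∈ℤ, l∈{1,…,N}} and {ψ_{m,n,l}}_{m,n∈ℤ, l∈{1,…,N}} be frames for L²(ℝ) with frame bounds A_1, B_1 and A_2, B_2 respectively, and let Θ_1, Θ_2 be bounded linear operators on L²(ℝ) whose adjoints Θ_1*, Θ_2* are bounded below by m_1 > 0 and m_2 > 0. Then for every f ∈ L²(ℝ), Σ_{l=1}^{N} Σ_{m,n∈ℤ} |⟨f, Θ_1 φ_{m,n,l} + Θ_2 ψ_{m,n,l}⟩|² ≥ (A_1 m_1² + A_2 m_2² − 2 √(B_1 B_2) ‖Θ_1‖ ‖Θ_2‖) ‖f‖². -/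
open MeasureTheory ContinuousLinearMap
open scoped ComplexInnerProductSpace

noncomputable section

lemma IsFrame.summable_aux {N : ℕ} {g : ℤ × ℤ × Fin N → L2R} {A B : ℝ}
    (h : IsFrame g A B) (f : L2R) : Summable (fun idx => ‖(⟪f, g idx⟫)‖ ^ 2) := by
  by_cases hf : f = 0
  · subst hf
    simpa using (summable_zero : Summable (fun _ : ℤ × ℤ × Fin N => (0 : ℝ)))
  · by_contra hs
    have h1 := (h.2.2 f).1
    rw [tsum_eq_zero_of_not_summable hs] at h1
    have h2 : 0 < ‖f‖ := norm_pos_iff.mpr hf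
    have h3 : 0 < A * ‖f‖ ^ 2 := mul_pos h.1 (by positivity)
    linarith

/-- If `{φₐ}`, `{ψₐ}` are frames for `L²(ℝ)` with bounds `A₁, B₁` and `A₂, B₂`, and
`Θ₁, Θ₂` are bounded linear operators on `L²(ℝ)` whose adjoints are bounded below by
`m₁ > 0`, `m₂ > 0`, then for every `f ∈ L²(ℝ)`,
`Σ |⟨f, Θ₁ φₐ + Θ₂ ψₐ⟩|² ≥ (A₁ m₁² + A₂ m₂² − 2 √(B₁ B₂) ‖Θ₁‖ ‖Θ₂‖) ‖f‖²`. -/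
theorem operator_sum_of_frames_lower_bound (N : ℕ)
    (φ ψ : ℤ × ℤ × Fin N → L2R) (A₁ B₁ A₂ B₂ : ℝ)
    (hφ : IsFrame φ A₁ B₁) (hψ : IsFrame ψ A₂ B₂)
    (Θ₁ Θ₂ : L2R →L[ℂ] L2R) (m₁ m₂ : ℝ) (hm₁ : 0 < m₁) (hm₂ : 0 < m₂)
    (hΘ₁ : ∀ f : L2R, m₁ * ‖f‖ ≤ ‖adjoint Θ₁ f‖)
    (hΘ₂ : ∀ f : L2R, m₂ * ‖f‖ ≤ ‖adjoint Θ₂ f‖)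
    (f : L2R) :
    (A₁ * m₁ ^ 2 + A₂ * m₂ ^ 2 - 2 * Real.sqrt (B₁ * B₂) * ‖Θ₁‖ * ‖Θ₂‖) * ‖f‖ ^ 2
      ≤ ∑' idx : ℤ × ℤ × Fin N, ‖(⟪f, Θ₁ (φ idx) + Θ₂ (ψ idx)⟫)‖ ^ 2 := by
  have hA₁ := hφ.1
  have hA₂ := hψ.1
  have hB₁ : 0 < B₁ := lt_of_lt_of_le hφ.1 hφ.2.1
  have hB₂ : 0 < B₂ := lt_of_lt_of_le hψ.1 hψ.2.1
  obtain ⟨hl₁, hu₁⟩ := hφ.2.2 (adjoint Θ₁ f)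
  obtain ⟨hl₂, hu₂⟩ := hψ.2.2 (adjoint Θ₂ f)
  have sa := hφ.summable_aux (adjoint Θ₁ f)
  have sb := hψ.summable_aux (adjoint Θ₂ f)
  have nu : ‖adjoint Θ₁ f‖ ≤ ‖Θ₁‖ * ‖f‖ := by
    simpa using (adjoint Θ₁).le_opNorm f
  have nv : ‖adjoint Θ₂ f‖ ≤ ‖Θ₂‖ * ‖f‖ := by
    simpa using (adjoint Θ₂).le_opNorm f
  have key : ∀ idx, ⟪f, Θ₁ (φ idx) + Θ₂ (ψ idx)⟫
      = ⟪adjoint Θ₁ f, φ idx⟫ + ⟪adjoint Θ₂ f, ψ idx⟫ := by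
    intro idx
    rw [inner_add_right, adjoint_inner_left, adjoint_inner_left]
  simp_rw [key]
  have lu := hΘ₁ f
  have lv := hΘ₂ f
  generalize adjoint Θ₁ f = u at *
  generalize adjoint Θ₂ f = v at *
  have sab : Summable (fun idx => ‖(⟪u, φ idx⟫)‖ * ‖(⟪v, ψ idx⟫)‖) := by
    refine Summable.of_nonneg_of_le (fun _ => by positivity) (fun idx => ?_) (sa.add sb)
    nlinarith [sq_nonneg (‖(⟪u, φ idx⟫)‖ - ‖(⟪v, ψ idx⟫)‖), sq_nonneg (‖(⟪u, φ idx⟫)‖),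
      sq_nonneg (‖(⟪v, ψ idx⟫)‖)]
  have ss : Summable (fun idx => ‖(⟪u, φ idx⟫) + (⟪v, ψ idx⟫)‖ ^ 2) := by
    refine Summable.of_nonneg_of_le (fun _ => by positivity) (fun idx => ?_)
      ((sa.add sb).mul_left 2)
    have h := norm_add_le (⟪u, φ idx⟫) (⟪v, ψ idx⟫)
    have h2 := pow_le_pow_left₀ (norm_nonneg _) h 2
    nlinarith [sq_nonneg (‖(⟪u, φ idx⟫)‖ - ‖(⟪v, ψ idx⟫)‖)]
  have cs : ∑' idx, ‖(⟪u, φ idx⟫)‖ * ‖(⟪v, ψ idx⟫)‖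
      ≤ Real.sqrt (B₁ * B₂) * ‖Θ₁‖ * ‖Θ₂‖ * ‖f‖ ^ 2 := by
    refine sab.tsum_le_of_sum_le (fun s => ?_)
    have c1 : ∑ i ∈ s, ‖(⟪u, φ i⟫)‖ ^ 2 ≤ B₁ * (‖Θ₁‖ * ‖f‖) ^ 2 :=
      (sa.sum_le_tsum s (fun _ _ => by positivity)).trans (hu₁.trans (by gcongr))
    have c2 : ∑ i ∈ s, ‖(⟪v, ψ i⟫)‖ ^ 2 ≤ B₂ * (‖Θ₂‖ * ‖f‖) ^ 2 :=
      (sb.sum_le_tsum s (fun _ _ => by positivity)).trans (hu₂.trans (by gcongr))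
    have c3 := Finset.sum_mul_sq_le_sq_mul_sq s (fun i => ‖(⟪u, φ i⟫)‖) (fun i => ‖(⟪v, ψ i⟫)‖)
    refine (sq_le_sq₀ (Finset.sum_nonneg fun _ _ => by positivity) (by positivity)).mp ?_
    refine c3.trans ((mul_le_mul c1 c2 (Finset.sum_nonneg fun _ _ => by positivity)
      (by positivity)).trans (le_of_eq ?_))
    have := Real.sq_sqrt (mul_pos hB₁ hB₂).le
    simp only [mul_pow]
    rw [Real.sq_sqrt (mul_pos hB₁ hB₂).le]
    ring
  have low : ∑' idx, (‖(⟪u, φ idx⟫)‖ ^ 2 + ‖(⟪v, ψ idx⟫)‖ ^ 2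
        - 2 * (‖(⟪u, φ idx⟫)‖ * ‖(⟪v, ψ idx⟫)‖))
      ≤ ∑' idx, ‖(⟪u, φ idx⟫) + (⟪v, ψ idx⟫)‖ ^ 2 := by
    refine Summable.tsum_le_tsum (fun idx => ?_) ((sa.add sb).sub (sab.mul_left 2)) ss
    have h := abs_norm_sub_norm_le (⟪u, φ idx⟫) (-(⟪v, ψ idx⟫))
    rw [norm_neg, sub_neg_eq_add] at h
    have h2 := pow_le_pow_left₀ (abs_nonneg _) h 2
    rw [sq_abs] at h2
    linarith
  rw [(sa.add sb).tsum_sub (sab.mul_left 2), sa.tsum_add sb, tsum_mul_left] at low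
  have p1 : A₁ * (m₁ * ‖f‖) ^ 2 ≤ A₁ * ‖u‖ ^ 2 := by gcongr
  have p2 : A₂ * (m₂ * ‖f‖) ^ 2 ≤ A₂ * ‖v‖ ^ 2 := by gcongr
  linarith
end
end

section
/- Let N be a natural number, let {φ_{m,n,l}}_{m,n∈ℤ, l∈{1,…,N}} and {ψ_{m,n,l}}_{m,n∈ℤ, l∈{1,…,N}} be frames for L²(ℝ) with frame bounds A_1, B_1 and A_2, B_2 respectively, and let {α_{m,n,l}} and {β_{m,n,l}} be bounded families of complex scalars indexed by ℤ×ℤ×{1,…,N}. Then for every f ∈ L²(ℝ), Σ_{l=1}^{N} Σ_{m,n∈ℤ} |⟨f, α_{m,n,l} φ_{m,n,l} + β_{m,n,l} ψ_{m,n,l}⟩|² ≥ ((inf |α_{m,n,l}|)² A_1 + (inf |β_{m,n,l}|)² A_2 − 2 (sup |α_{m,n,l}|)(sup |β_{m,n,l}|) √(B_1 B_2)) ‖f‖². -/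
open MeasureTheory
open scoped ComplexInnerProductSpace

noncomputable section

/-- If `{φₐ}`, `{ψₐ}` are frames for `L²(ℝ)` with bounds `A₁, B₁` and `A₂, B₂`, and
`{αₐ}`, `{βₐ}` are bounded families of scalars, then for every `f ∈ L²(ℝ)`,
`Σ |⟨f, αₐ φₐ + βₐ ψₐ⟩|² ≥ ((inf|αₐ|)² A₁ + (inf|βₐ|)² A₂ − 2 (sup|αₐ|)(sup|βₐ|) √(B₁B₂)) ‖f‖²`. -/
theorem perturbed_sum_of_frames_lower_bound (N : ℕ)
    (φ ψ : ℤ × ℤ × Fin N → L2R) (A₁ B₁ A₂ B₂ : ℝ)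
    (hφ : IsFrame φ A₁ B₁) (hψ : IsFrame ψ A₂ B₂)
    (α β : ℤ × ℤ × Fin N → ℂ)
    (hα : BddAbove (Set.range fun idx => ‖α idx‖))
    (hβ : BddAbove (Set.range fun idx => ‖β idx‖))
    (f : L2R) :
    ((⨅ idx, ‖α idx‖) ^ 2 * A₁ + (⨅ idx, ‖β idx‖) ^ 2 * A₂
        - 2 * (⨆ idx, ‖α idx‖) * (⨆ idx, ‖β idx‖) * Real.sqrt (B₁ * B₂)) * ‖f‖ ^ 2
      ≤ ∑' idx : ℤ × ℤ × Fin N, ‖(⟪f, α idx • φ idx + β idx • ψ idx⟫)‖ ^ 2 := by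
  rcases eq_or_ne f 0 with rfl | hf
  · simp
  have hfn : 0 < ‖f‖ ^ 2 := by positivity
  obtain ⟨hA₁, hAB₁, h₁⟩ := hφ
  obtain ⟨hA₂, hAB₂, h₂⟩ := hψ
  obtain ⟨hl₁, hu₁⟩ := h₁ f
  obtain ⟨hl₂, hu₂⟩ := h₂ f
  have hs : ∀ (u : ℤ × ℤ × Fin N → ℝ) (A : ℝ), 0 < A → A * ‖f‖ ^ 2 ≤ ∑' i, u i → Summable u := by
    intro u A hA h
    by_contra hn
    rw [tsum_eq_zero_of_not_summable hn] at h
    have := mul_pos hA hfn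
    linarith
  have hsu := hs _ _ hA₁ hl₁
  have hsv := hs _ _ hA₂ hl₂
  set u : ℤ × ℤ × Fin N → ℝ := fun i => ‖(⟪f, φ i⟫)‖ with hu
  set v : ℤ × ℤ × Fin N → ℝ := fun i => ‖(⟪f, ψ i⟫)‖ with hv
  change Summable (fun i => u i ^ 2) at hsu
  change Summable (fun i => v i ^ 2) at hsv
  change A₁ * ‖f‖ ^ 2 ≤ ∑' i, u i ^ 2 at hl₁
  change A₂ * ‖f‖ ^ 2 ≤ ∑' i, v i ^ 2 at hl₂
  change ∑' i, u i ^ 2 ≤ B₁ * ‖f‖ ^ 2 at hu₁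
  change ∑' i, v i ^ 2 ≤ B₂ * ‖f‖ ^ 2 at hu₂
  have hu0 : ∀ i, 0 ≤ u i := fun i => norm_nonneg _
  have hv0 : ∀ i, 0 ≤ v i := fun i => norm_nonneg _
  have hcs := Real.inner_le_Lp_mul_Lq_tsum_of_nonneg Real.HolderConjugate.two_two hu0 hv0
    (by simpa using hsu) (by simpa using hsv)
  have hsuv : Summable fun i => u i * v i := by
    refine Summable.of_nonneg_of_le (fun i => mul_nonneg (hu0 i) (hv0 i)) (fun i => ?_)
      (hsu.add hsv)
    nlinarith [sq_nonneg (u i - v i), sq_nonneg (u i), sq_nonneg (v i)]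
  simp only [Real.rpow_ofNat, ← Real.sqrt_eq_rpow] at hcs
  have hB : ∑' i, u i * v i ≤ Real.sqrt (B₁ * B₂) * ‖f‖ ^ 2 := by
    refine hcs.trans ?_
    rw [← Real.sqrt_mul (tsum_nonneg fun i => sq_nonneg _)]
    have h3 : Real.sqrt (B₁ * B₂) * ‖f‖ ^ 2 = Real.sqrt ((B₁ * ‖f‖ ^ 2) * (B₂ * ‖f‖ ^ 2)) := by
      rw [show (B₁ * ‖f‖ ^ 2) * (B₂ * ‖f‖ ^ 2) = (B₁ * B₂) * (‖f‖ ^ 2) ^ 2 by ring,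
        Real.sqrt_mul (mul_nonneg (by linarith) (by linarith)), Real.sqrt_sq hfn.le]
    rw [h3]
    apply Real.sqrt_le_sqrt
    exact mul_le_mul hu₁ hu₂ (tsum_nonneg fun i => sq_nonneg _)
      (mul_nonneg (by linarith) hfn.le)
  set a := ⨅ idx, ‖α idx‖ with ha
  set b := ⨅ idx, ‖β idx‖ with hb
  set P := ⨆ idx, ‖α idx‖ with hP
  set Q := ⨆ idx, ‖β idx‖ with hQ
  have ha0 : 0 ≤ a := Real.iInf_nonneg fun _ => norm_nonneg _
  have hb0 : 0 ≤ b := Real.iInf_nonneg fun _ => norm_nonneg _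
  have hP0 : 0 ≤ P := Real.iSup_nonneg fun _ => norm_nonneg _
  have hQ0 : 0 ≤ Q := Real.iSup_nonneg fun _ => norm_nonneg _
  have hai : ∀ i, a ≤ ‖α i‖ := fun i => ciInf_le ⟨0, by rintro _ ⟨j, rfl⟩; exact norm_nonneg _⟩ i
  have hbi : ∀ i, b ≤ ‖β i‖ := fun i => ciInf_le ⟨0, by rintro _ ⟨j, rfl⟩; exact norm_nonneg _⟩ i
  have hPi : ∀ i, ‖α i‖ ≤ P := fun i => le_ciSup hα i
  have hQi : ∀ i, ‖β i‖ ≤ Q := fun i => le_ciSup hβ i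
  have hterm : ∀ i, (⟪f, α i • φ i + β i • ψ i⟫) = α i * (⟪f, φ i⟫) + β i * (⟪f, ψ i⟫) := by
    intro i
    rw [inner_add_right, inner_smul_right, inner_smul_right]
  have hup : ∀ i, ‖(⟪f, α i • φ i + β i • ψ i⟫)‖ ≤ P * u i + Q * v i := by
    intro i
    rw [hterm]
    refine (norm_add_le _ _).trans ?_
    rw [norm_mul, norm_mul]
    exact add_le_add (mul_le_mul_of_nonneg_right (hPi i) (hu0 i))
      (mul_le_mul_of_nonneg_right (hQi i) (hv0 i))
  have hsT : Summable fun i => ‖(⟪f, α i • φ i + β i • ψ i⟫)‖ ^ 2 := by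
    refine Summable.of_nonneg_of_le (fun i => sq_nonneg _) (fun i => ?_)
      ((hsu.mul_left (2 * P ^ 2)).add (hsv.mul_left (2 * Q ^ 2)))
    have := pow_le_pow_left₀ (norm_nonneg _) (hup i) 2
    nlinarith [sq_nonneg (P * u i - Q * v i)]
  have hlow : ∀ i, a ^ 2 * u i ^ 2 + b ^ 2 * v i ^ 2 - 2 * P * Q * (u i * v i)
      ≤ ‖(⟪f, α i • φ i + β i • ψ i⟫)‖ ^ 2 := by
    intro i
    rw [hterm]
    have h1 := abs_norm_sub_norm_le (α i * (⟪f, φ i⟫)) (-(β i * (⟪f, ψ i⟫)))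
    rw [sub_neg_eq_add, norm_neg, norm_mul, norm_mul] at h1
    have h2 := pow_le_pow_left₀ (abs_nonneg _) h1 2
    rw [sq_abs] at h2
    change (‖α i‖ * u i - ‖β i‖ * v i) ^ 2 ≤ _ at h2
    have h3 : a ^ 2 * u i ^ 2 ≤ ‖α i‖ ^ 2 * u i ^ 2 :=
      mul_le_mul_of_nonneg_right (pow_le_pow_left₀ ha0 (hai i) 2) (sq_nonneg _)
    have h4 : b ^ 2 * v i ^ 2 ≤ ‖β i‖ ^ 2 * v i ^ 2 :=
      mul_le_mul_of_nonneg_right (pow_le_pow_left₀ hb0 (hbi i) 2) (sq_nonneg _)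
    have h5 : ‖α i‖ * ‖β i‖ * (u i * v i) ≤ P * Q * (u i * v i) :=
      mul_le_mul_of_nonneg_right (mul_le_mul (hPi i) (hQi i) (norm_nonneg _) hP0)
        (mul_nonneg (hu0 i) (hv0 i))
    nlinarith
  have hsL := ((hsu.mul_left (a ^ 2)).add (hsv.mul_left (b ^ 2))).sub (hsuv.mul_left (2 * P * Q))
  have hfin := hsL.tsum_le_tsum hlow hsT
  rw [((hsu.mul_left (a ^ 2)).add (hsv.mul_left (b ^ 2))).tsum_sub (hsuv.mul_left (2 * P * Q)),
    (hsu.mul_left (a ^ 2)).tsum_add (hsv.mul_left (b ^ 2)), tsum_mul_left, tsum_mul_left,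
    tsum_mul_left] at hfin
  have e1 := mul_le_mul_of_nonneg_left hl₁ (sq_nonneg a)
  have e2 := mul_le_mul_of_nonneg_left hl₂ (sq_nonneg b)
  have e3 := mul_le_mul_of_nonneg_left hB (mul_nonneg (mul_nonneg zero_le_two hP0) hQ0)
  linarith
end
end
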